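/- There is an absolute constant c > 0 with the following property. Let f be a random p-biased function on 𝒳 with p ∈ (0,1), let ε ∈ (0,1], φ : 𝒳 → [0,1], and let π : 𝒳 → 𝒳 be a permutation with no fixed points. Then with probability at least 1 − 8·exp(−c·ε²·p²(1−p)² / ‖𝒟_x‖₂²) over the randomness of f, the normalization factor Z is strictly positive and the filtered sample distribution 𝒟 satisfies |Σ_{x∈𝒳} 𝒟(x)φ(x)f(x)f(π(x)) − p·Σ_{x∈𝒳} 𝒟_x(x)φ(x)y(x)| ≤ ε. -/

import Mathlib

open Finset Real
open scoped Classical BigOperators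

noncomputable section

/-- The real value of a boolean function at a point: `1` if `true`, `0` if `false`. -/
def bval {X : Type} (f : X → Bool) (x : X) : ℝ := if f x then 1 else 0

/-- The probability weight of a particular function `f : X → Bool` when each value
`f x` is an independent Bernoulli(p) random variable. -/
def bweight {X : Type} [Fintype X] (p : ℝ) (f : X → Bool) : ℝ :=
  ∏ x, if f x then p else 1 - p

/-- The probability of an event `P` under a random `p`-biased function. -/
def bprob (X : Type) [Fintype X] (p : ℝ) (P : (X → Bool) → Prop) : ℝ :=
  ∑ f : X → Bool, bweight p f * (if P f then 1 else 0)

/-- The squared 2-norm of a weight function. -/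
def norm2sq {X : Type} [Fintype X] (w : X → ℝ) : ℝ := ∑ x, w x ^ 2

/-- The normalization factor `Z`. -/
def Zval {X : Type} [Fintype X] (Dx yy : X → ℝ) (p : ℝ) (f : X → Bool) : ℝ :=
  ∑ x, Dx x * ((1 - p) * yy x * bval f x + p * (1 - yy x) * (1 - bval f x))

/-- The filtered sample distribution. -/
def filtered {X : Type} [Fintype X] (Dx yy : X → ℝ) (p : ℝ) (f : X → Bool) (x : X) : ℝ :=
  Dx x * ((1 - p) * yy x * bval f x + p * (1 - yy x) * (1 - bval f x)) / Zval Dx yy p f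

/-- Expectation under a random `p`-biased function. -/
def bEx (X : Type) [Fintype X] (p : ℝ) (F : (X → Bool) → ℝ) : ℝ :=
  ∑ f : X → Bool, bweight p f * F f

theorem bweight_nonneg {X : Type} [Fintype X] {p : ℝ} (h0 : 0 < p) (h1 : p < 1) (f : X → Bool) :
    0 ≤ bweight p f := by
  unfold bweight
  apply Finset.prod_nonneg
  intro x _
  split_ifs <;> linarith

theorem bEx_mono {X : Type} [Fintype X] {p : ℝ} (h0 : 0 < p) (h1 : p < 1)
    {F G : (X → Bool) → ℝ} (h : ∀ f, F f ≤ G f) : bEx X p F ≤ bEx X p G := by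
  unfold bEx
  exact Finset.sum_le_sum fun f _ => mul_le_mul_of_nonneg_left (h f) (bweight_nonneg h0 h1 f)

theorem bEx_add {X : Type} [Fintype X] {p : ℝ} (F G : (X → Bool) → ℝ) :
    bEx X p (fun f => F f + G f) = bEx X p F + bEx X p G := by
  simp [bEx, mul_add, Finset.sum_add_distrib]

theorem bEx_sub {X : Type} [Fintype X] {p : ℝ} (F G : (X → Bool) → ℝ) :
    bEx X p (fun f => F f - G f) = bEx X p F - bEx X p G := by
  simp [bEx, mul_sub, Finset.sum_sub_distrib]

theorem bEx_const_mul {X : Type} [Fintype X] {p : ℝ} (a : ℝ) (F : (X → Bool) → ℝ) :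
    bEx X p (fun f => a * F f) = a * bEx X p F := by
  simp only [bEx, Finset.mul_sum]
  exact Finset.sum_congr rfl fun f _ => by ring

theorem bEx_sum {X : Type} [Fintype X] {p : ℝ} {ι : Type} (s : Finset ι)
    (F : ι → (X → Bool) → ℝ) :
    bEx X p (fun f => ∑ i ∈ s, F i f) = ∑ i ∈ s, bEx X p (F i) := by
  simp only [bEx, Finset.mul_sum]
  exact Finset.sum_comm

theorem bEx_prod {X : Type} [Fintype X] (p : ℝ) (S : Finset X) :
    bEx X p (fun f => ∏ x ∈ S, bval f x) = p ^ S.card := by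
  have h : ∀ f : X → Bool, bweight p f * ∏ x ∈ S, bval f x =
      ∏ x, (if f x then p else 1 - p) * (if x ∈ S then (if f x then (1:ℝ) else 0) else 1) := by
    intro f
    rw [Finset.prod_mul_distrib, Finset.prod_ite_mem]
    simp [bweight, bval]
  unfold bEx
  rw [Finset.sum_congr rfl fun f _ => h f]
  have := Fintype.prod_sum (fun (x : X) (b : Bool) =>
    (if b then p else 1 - p) * (if x ∈ S then (if b then (1:ℝ) else 0) else 1))
  rw [← this]
  have h2 : ∀ x : X, (∑ b : Bool,
      (if b then p else 1 - p) * (if x ∈ S then (if b then (1:ℝ) else 0) else 1))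
      = if x ∈ S then p else 1 := by
    intro x
    by_cases hx : x ∈ S <;> simp [hx]
  rw [Finset.prod_congr rfl fun x _ => h2 x, Finset.prod_ite_mem]
  simp

theorem bEx_const {X : Type} [Fintype X] (p a : ℝ) : bEx X p (fun _ => a) = a := by
  have h1 := bEx_prod p (∅ : Finset X)
  have h2 := bEx_const_mul (X := X) (p := p) a (fun f => ∏ x ∈ (∅ : Finset X), bval f x)
  rw [h1] at h2
  simpa using h2

theorem bEx_bval {X : Type} [Fintype X] (p : ℝ) (x : X) : bEx X p (fun f => bval f x) = p := by
  simpa using bEx_prod p ({x} : Finset X)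

theorem bEx_bval2 {X : Type} [Fintype X] (p : ℝ) (x y : X) (h : x ≠ y) :
    bEx X p (fun f => bval f x * bval f y) = p ^ 2 := by
  have := bEx_prod p ({x, y} : Finset X)
  rw [Finset.card_pair h] at this
  rw [← this]
  congr 1
  funext f
  rw [Finset.prod_pair h]

theorem bern_mgf0 {p : ℝ} (h0 : 0 < p) (h1 : p < 1) (s : ℝ) :
    p * exp ((1 - p) * s) + (1 - p) * exp (-(p * s)) ≤ exp (s ^ 2 / 2) := by
  have hB : 1 ≤ p * exp (-((1 - p) * s)) + (1 - p) * exp (p * s) := by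
    have e1 := Real.add_one_le_exp (-((1 - p) * s))
    have e2 := Real.add_one_le_exp (p * s)
    nlinarith [mul_le_mul_of_nonneg_left e1 h0.le,
      mul_le_mul_of_nonneg_left e2 (sub_pos.2 h1).le]
  have hA : 0 ≤ p * exp ((1 - p) * s) + (1 - p) * exp (-(p * s)) := by
    have := exp_pos ((1 - p) * s)
    have := exp_pos (-(p * s))
    have := sub_pos.2 h1
    positivity
  have hAB : (p * exp ((1 - p) * s) + (1 - p) * exp (-(p * s))) *
      (p * exp (-((1 - p) * s)) + (1 - p) * exp (p * s)) =
      p ^ 2 + (1 - p) ^ 2 + 2 * p * (1 - p) * cosh s := by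
    have a1 : exp ((1 - p) * s) * exp (-((1 - p) * s)) = 1 := by rw [← exp_add]; simp
    have a2 : exp (-(p * s)) * exp (p * s) = 1 := by rw [← exp_add]; simp
    have a3 : exp ((1 - p) * s) * exp (p * s) = exp s := by rw [← exp_add]; ring_nf
    have a4 : exp (-(p * s)) * exp (-((1 - p) * s)) = exp (-s) := by rw [← exp_add]; ring_nf
    rw [cosh_eq]
    linear_combination p ^ 2 * a1 + (1 - p) ^ 2 * a2 + p * (1 - p) * a3 + p * (1 - p) * a4
  have hc := Real.cosh_le_exp_half_sq s
  have hc1 := Real.one_le_cosh s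
  calc _ ≤ _ := le_mul_of_one_le_right hA hB
    _ = _ := hAB
    _ ≤ cosh s := by 
        nlinarith [mul_nonneg (sq_nonneg p) (sub_nonneg.2 hc1),
          mul_nonneg (sq_nonneg (1 - p)) (sub_nonneg.2 hc1)]
    _ ≤ _ := hc

theorem bern_mgf {p : ℝ} (h0 : 0 < p) (h1 : p < 1) (a b d : ℝ) (h : |a - b| ≤ d) :
    p * exp a + (1 - p) * exp b ≤ exp (p * a + (1 - p) * b + d ^ 2 / 2) := by
  have h2 := bern_mgf0 h0 h1 (a - b)
  have h3 : (a - b) ^ 2 ≤ d ^ 2 := by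
    rw [← sq_abs (a - b)]
    exact pow_le_pow_left₀ (abs_nonneg _) h 2
  have e1 : exp a = exp (p * a + (1 - p) * b) * exp ((1 - p) * (a - b)) := by
    rw [← exp_add]; ring_nf
  have e2 : exp b = exp (p * a + (1 - p) * b) * exp (-(p * (a - b))) := by
    rw [← exp_add]; ring_nf
  calc p * exp a + (1 - p) * exp b = exp (p * a + (1 - p) * b) *
        (p * exp ((1 - p) * (a - b)) + (1 - p) * exp (-(p * (a - b)))) := by
        rw [e1, e2]; ring
    _ ≤ exp (p * a + (1 - p) * b) * exp ((a - b) ^ 2 / 2) :=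
        mul_le_mul_of_nonneg_left h2 (exp_pos _).le
    _ ≤ _ := by
        rw [← exp_add]
        apply exp_le_exp.2
        linarith

/-- Extend a function on `α` by a value at `none`. -/
def optCons {α : Type} (b : Bool) (g : α → Bool) : Option α → Bool
  | none => b
  | some a => g a

theorem bEx_option {α : Type} [Fintype α] (p : ℝ) (F : (Option α → Bool) → ℝ) :
    bEx (Option α) p F = p * bEx α p (fun g => F (optCons true g))
      + (1 - p) * bEx α p (fun g => F (optCons false g)) := by
  have key : bEx (Option α) p F =
      ∑ q : Bool × (α → Bool), bweight p (optCons q.1 q.2) * F (optCons q.1 q.2) := by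
    unfold bEx
    symm
    refine Finset.sum_bijective (fun q : Bool × (α → Bool) => optCons q.1 q.2) ?_ (by simp) ?_
    · constructor
      · rintro ⟨b, g⟩ ⟨b', g'⟩ h
        have h1 := congrFun h none
        have h2 : g = g' := funext fun a => congrFun h (some a)
        simp only [optCons] at h1
        rw [h1, h2]
      · intro f
        exact ⟨(f none, fun a => f (some a)), by funext x; cases x <;> rfl⟩
    · intro q _; rfl
  have hw : ∀ b (g : α → Bool), bweight p (optCons b g) =
      (if b then p else 1 - p) * bweight p g := by
    intro b g
    simp only [bweight, Fintype.prod_option, optCons]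
    congr
  rw [key, Fintype.sum_prod_type]
  simp [hw, bEx, Finset.mul_sum, mul_assoc]

theorem bEx_equiv {α β : Type} [Fintype α] [Fintype β] (e : α ≃ β) (p : ℝ)
    (F : (β → Bool) → ℝ) : bEx β p F = bEx α p (fun g => F (g ∘ e.symm)) := by
  unfold bEx
  symm
  apply Fintype.sum_equiv (e.arrowCongr (Equiv.refl Bool))
  intro g
  have : (e.arrowCongr (Equiv.refl Bool)) g = g ∘ e.symm := rfl
  rw [this]
  congr 1
  unfold bweight
  apply Fintype.prod_equiv e
  simp

/-- Bounded differences. -/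
def BD {X : Type} (F : (X → Bool) → ℝ) (c : X → ℝ) : Prop :=
  ∀ x f g, (∀ z, z ≠ x → f z = g z) → |F f - F g| ≤ c x

theorem mcdiarmid_mgf {p : ℝ} (h0 : 0 < p) (h1 : p < 1) (X : Type) [Fintype X] :
    ∀ (F : (X → Bool) → ℝ) (c : X → ℝ), BD F c →
      bEx X p (fun f => exp (F f)) ≤ exp (bEx X p F + (∑ x, c x ^ 2) / 2) := by
  refine Fintype.induction_empty_option (P := fun (X : Type) [Fintype X] =>
    ∀ (F : (X → Bool) → ℝ) (c : X → ℝ), BD F c →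
      bEx X p (fun f => exp (F f)) ≤ exp (bEx X p F + (∑ x, c x ^ 2) / 2)) ?_ ?_ ?_ X
  · intro α β _ e ih F c hF
    let _ : Fintype α := Fintype.ofEquiv β e.symm
    have := ih (fun g => F (g ∘ e.symm)) (fun a => c (e a)) (by
      intro x f g h
      apply hF
      intro z hz
      apply h
      intro h'
      apply hz
      rw [← h']; simp)
    rw [bEx_equiv e, bEx_equiv e p F]
    refine this.trans (le_of_eq ?_)
    congr 3
    exact Fintype.sum_equiv e _ _ (fun _ => rfl)
  · intro F c hF
    have hc : F = fun _ => F (fun _ => true) := by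
      funext f; congr 1; funext x; exact x.elim
    rw [hc, bEx_const, bEx_const]
    simp
  · intro α _ ih F c hF
    have ih' : ∀ b, bEx α p (fun g => exp (F (optCons b g))) ≤
        exp (bEx α p (fun g => F (optCons b g)) + (∑ x, c (some x) ^ 2) / 2) := by
      intro b
      apply ih (fun g => F (optCons b g)) (fun a => c (some a))
      intro x f g h
      apply hF
      rintro (_ | z) hz
      · rfl
      · exact h z (fun h' => hz (by rw [h']))
    rw [bEx_option, bEx_option, Fintype.sum_option]
    have hd : |bEx α p (fun g => F (optCons true g)) - bEx α p (fun g => F (optCons false g))|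
        ≤ c none := by
      have hb : ∀ g : α → Bool, |F (optCons true g) - F (optCons false g)| ≤ c none := by
        intro g
        apply hF
        rintro (_ | z) hz
        · exact absurd rfl hz
        · rfl
      rw [← bEx_sub, abs_le]
      constructor
      · rw [← bEx_const (X := α) p (-c none)]
        exact bEx_mono h0 h1 fun g => (abs_le.1 (hb g)).1
      · rw [← bEx_const (X := α) p (c none)]
        exact bEx_mono h0 h1 fun g => (abs_le.1 (hb g)).2
    have hm := bern_mgf h0 h1 (bEx α p (fun g => F (optCons true g)) + (∑ x, c (some x) ^ 2) / 2)
      (bEx α p (fun g => F (optCons false g)) + (∑ x, c (some x) ^ 2) / 2) (c none) (by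
        rw [add_sub_add_right_eq_sub]; exact hd)
    calc _ ≤ _ := add_le_add (mul_le_mul_of_nonneg_left (ih' true) h0.le)
          (mul_le_mul_of_nonneg_left (ih' false) (sub_pos.2 h1).le)
      _ ≤ _ := hm
      _ = _ := by congr 1; ring

theorem mcdiarmid {p : ℝ} (h0 : 0 < p) (h1 : p < 1) {X : Type} [Fintype X]
    (F : (X → Bool) → ℝ) (c : X → ℝ) (hF : BD F c) (C t : ℝ) (hC : 0 < C)
    (hcC : ∑ x, c x ^ 2 ≤ C) (ht : 0 ≤ t) :
    bEx X p (fun f => if F f - bEx X p F > t then 1 else 0) ≤ exp (-(t ^ 2 / (2 * C))) := by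
  set l := t / C with hl
  have hl0 : 0 ≤ l := by positivity
  have hm := mcdiarmid_mgf h0 h1 X (fun f => l * F f) (fun x => l * c x) (by
    intro x f g h
    rw [← mul_sub, abs_mul, abs_of_nonneg hl0]
    exact mul_le_mul_of_nonneg_left (hF x f g h) hl0)
  rw [bEx_const_mul] at hm
  have hs : ∑ x, (l * c x) ^ 2 = l ^ 2 * ∑ x, c x ^ 2 := by
    rw [Finset.mul_sum]; exact Finset.sum_congr rfl fun x _ => by ring
  rw [hs] at hm
  calc _ ≤ bEx X p (fun f => exp (-(l * (bEx X p F + t))) * exp (l * F f)) := by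
        apply bEx_mono h0 h1
        intro f
        rw [← exp_add]
        split_ifs with h
        · apply Real.one_le_exp
          nlinarith [mul_le_mul_of_nonneg_left h.le hl0]
        · exact (exp_pos _).le
    _ = exp (-(l * (bEx X p F + t))) * bEx X p (fun f => exp (l * F f)) := bEx_const_mul _ _
    _ ≤ exp (-(l * (bEx X p F + t))) * exp (l * bEx X p F + l ^ 2 * (∑ x, c x ^ 2) / 2) :=
        mul_le_mul_of_nonneg_left hm (exp_pos _).le
    _ ≤ _ := by
        rw [← exp_add]
        apply exp_le_exp.2
        have e1 : l ^ 2 * ∑ x, c x ^ 2 ≤ l ^ 2 * C := mul_le_mul_of_nonneg_left hcC (sq_nonneg _)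
        have e2 : l ^ 2 * C = t ^ 2 / C := by rw [hl]; field_simp
        have e3 : l * t = t ^ 2 / C := by rw [hl]; ring
        have e4 : t ^ 2 / (2 * C) = t ^ 2 / C / 2 := by field_simp
        rw [e4]
        linarith

theorem mcdiarmid_abs {p : ℝ} (h0 : 0 < p) (h1 : p < 1) {X : Type} [Fintype X]
    (F : (X → Bool) → ℝ) (c : X → ℝ) (hF : BD F c) (C t : ℝ) (hC : 0 < C)
    (hcC : ∑ x, c x ^ 2 ≤ C) (ht : 0 ≤ t) :
    bEx X p (fun f => if |F f - bEx X p F| > t then 1 else 0) ≤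
      2 * exp (-(t ^ 2 / (2 * C))) := by
  have a := mcdiarmid h0 h1 F c hF C t hC hcC ht
  have b := mcdiarmid h0 h1 (fun f => (-1) * F f) c (by
    intro x f g h
    rw [← mul_sub, abs_mul]
    simpa using hF x f g h) C t hC hcC ht
  rw [bEx_const_mul] at b
  rw [two_mul]
  refine le_trans ?_ (add_le_add a b)
  rw [← bEx_add]
  apply bEx_mono h0 h1
  intro f
  by_cases h : |F f - bEx X p F| > t
  · rw [if_pos h]
    rcases lt_abs.1 h with h' | h'
    · rw [if_pos h']
      split_ifs <;> norm_num
    · have h3 : -1 * F f - -1 * bEx X p F > t := by linarith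
      rw [if_pos h3]
      split_ifs <;> norm_num
  · rw [if_neg h]
    split_ifs <;> norm_num

theorem bval_cases {X : Type} (f : X → Bool) (x : X) : bval f x = 0 ∨ bval f x = 1 := by
  unfold bval
  split_ifs <;> simp

theorem stmt8 : ∃ c : ℝ, 0 < c ∧
    ∀ (X : Type) [Fintype X], ∀ (Dx yy : X → ℝ) (p ε : ℝ) (φ : X → ℝ)
        (σ : Equiv.Perm X),
      (∀ x, 0 ≤ Dx x) → (∀ x, Dx x ≤ 1) → (∑ x, Dx x) = 1 →
      (∀ x, 0 ≤ yy x) → (∀ x, yy x ≤ 1) →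
      0 < p → p < 1 → 0 < ε → ε ≤ 1 →
      (∀ x, 0 ≤ φ x) → (∀ x, φ x ≤ 1) →
      (∀ x, σ x ≠ x) →
      bprob X p (fun f =>
          0 < Zval Dx yy p f ∧
          |(∑ x, filtered Dx yy p f x * φ x * bval f x * bval f (σ x))
            - p * ∑ x, Dx x * φ x * yy x| ≤ ε) ≥
        1 - 8 * Real.exp (-(c * ε ^ 2 * p ^ 2 * (1 - p) ^ 2) / norm2sq Dx) := by
  refine ⟨1 / 128, by norm_num, ?_⟩
  intro X _ D y p ε φ σ hD0 hD1 hDs hy0 hy1 h0 h1 he0 he1 hφ0 hφ1 hσ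
  have hn : 0 < norm2sq D := by
    unfold norm2sq
    by_contra hcon
    have hz : ∑ x, D x ^ 2 = 0 := le_antisymm (not_lt.1 hcon) (Finset.sum_nonneg fun x _ => sq_nonneg _)
    rw [Finset.sum_eq_zero_iff_of_nonneg (fun x _ => sq_nonneg _)] at hz
    have : ∑ x, D x = 0 := Finset.sum_eq_zero fun x hx => by simpa using hz x hx
    linarith
  have hq1 : 0 < 1 - p := by linarith
  set q := p * (1 - p) with hq
  have hq0 : 0 < q := by positivity
  set N : (X → Bool) → ℝ := fun f =>
    ∑ x, (D x * ((1 - p) * y x * φ x)) * (bval f x * bval f (σ x)) with hN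
  set c : X → ℝ := fun x => D x + D (σ.symm x) with hc
  have hcC : ∑ x, c x ^ 2 ≤ 4 * norm2sq D := by
    have e : ∑ x, D (σ.symm x) ^ 2 = ∑ x, D x ^ 2 := Equiv.sum_comp σ.symm (fun x => D x ^ 2)
    calc ∑ x, c x ^ 2 ≤ ∑ x, (2 * D x ^ 2 + 2 * D (σ.symm x) ^ 2) := by
          apply Finset.sum_le_sum
          intro x _
          simp only [hc]
          nlinarith [sq_nonneg (D x - D (σ.symm x))]
      _ = 4 * norm2sq D := by
          rw [Finset.sum_add_distrib, ← Finset.mul_sum, ← Finset.mul_sum, e]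
          unfold norm2sq
          ring
  have hEZ : bEx X p (Zval D y p) = q := by
    have : Zval D y p = fun f => ∑ x, (D x * (p * (1 - y x)) + D x * (y x - p) * bval f x) := by
      funext f
      unfold Zval
      exact Finset.sum_congr rfl fun x _ => by ring
    rw [this, bEx_sum]
    have h2 : ∀ x, bEx X p (fun f => D x * (p * (1 - y x)) + D x * (y x - p) * bval f x) = D x * q := by
      intro x
      rw [bEx_add, bEx_const, bEx_const_mul, bEx_bval, hq]
      ring
    rw [Finset.sum_congr rfl fun x _ => h2 x, ← Finset.sum_mul, hDs, one_mul]
  set μ := p * ∑ x, D x * φ x * y x with hμ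
  have hEN : bEx X p N = q * μ := by
    rw [hN, bEx_sum]
    have h2 : ∀ x, bEx X p (fun f => (D x * ((1 - p) * y x * φ x)) * (bval f x * bval f (σ x)))
        = q * p * (D x * φ x * y x) := by
      intro x
      rw [bEx_const_mul, bEx_bval2 p x (σ x) (hσ x).symm, hq]
      ring
    rw [Finset.sum_congr rfl fun x _ => h2 x, ← Finset.mul_sum, hμ]
    ring
  have hμ0 : 0 ≤ μ := mul_nonneg h0.le
    (Finset.sum_nonneg fun x _ => mul_nonneg (mul_nonneg (hD0 x) (hφ0 x)) (hy0 x))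
  have hμ1 : μ ≤ 1 := by
    have : ∑ x, D x * φ x * y x ≤ 1 := by
      rw [← hDs]
      apply Finset.sum_le_sum
      intro x _
      have e1 := mul_le_of_le_one_right (hD0 x) (hφ1 x)
      exact (mul_le_of_le_one_right (mul_nonneg (hD0 x) (hφ0 x)) (hy1 x)).trans e1
    rw [hμ]
    nlinarith
  have hBZ : BD (Zval D y p) c := by
    intro x f g h
    unfold Zval
    rw [← Finset.sum_sub_distrib]
    refine (Finset.abs_sum_le_sum_abs _ _).trans ?_
    have h2 : ∀ z ∈ Finset.univ,
        |D z * ((1 - p) * y z * bval f z + p * (1 - y z) * (1 - bval f z)) -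
        D z * ((1 - p) * y z * bval g z + p * (1 - y z) * (1 - bval g z))| ≤
        if z = x then D z else 0 := by
      intro z _
      have e : D z * ((1 - p) * y z * bval f z + p * (1 - y z) * (1 - bval f z)) -
        D z * ((1 - p) * y z * bval g z + p * (1 - y z) * (1 - bval g z)) =
        D z * ((y z - p) * (bval f z - bval g z)) := by ring
      rw [e]
      split_ifs with hz
      · rw [abs_mul, abs_of_nonneg (hD0 z), abs_mul]
        apply mul_le_of_le_one_right (hD0 z)
        apply mul_le_one₀ _ (abs_nonneg _)
        · rcases bval_cases f z with h | h <;> rcases bval_cases g z with h' | h' <;> simp [h, h']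
        · rw [abs_le]; constructor <;> linarith [hy0 z, hy1 z]
      · have : bval f z = bval g z := by unfold bval; rw [h z hz]
        simp [this]
    refine (Finset.sum_le_sum h2).trans ?_
    rw [Finset.sum_ite_eq' Finset.univ x]
    simp only [Finset.mem_univ, if_true, hc]
    linarith [hD0 (σ.symm x)]
  have hBN : BD N c := by
    intro x f g h
    simp only [hN]
    rw [← Finset.sum_sub_distrib]
    refine (Finset.abs_sum_le_sum_abs _ _).trans ?_
    have h2 : ∀ z ∈ Finset.univ,
        |D z * ((1 - p) * y z * φ z) * (bval f z * bval f (σ z)) -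
        D z * ((1 - p) * y z * φ z) * (bval g z * bval g (σ z))| ≤
        (if z = x then D z else 0) + (if z = σ.symm x then D z else 0) := by
      intro z _
      by_cases hz : z = x ∨ z = σ.symm x
      · have e1 : |D z * ((1 - p) * y z * φ z) * (bval f z * bval f (σ z)) -
            D z * ((1 - p) * y z * φ z) * (bval g z * bval g (σ z))| ≤ D z := by
          rw [← mul_sub, mul_assoc, abs_mul, abs_of_nonneg (hD0 z), abs_mul]
          apply mul_le_of_le_one_right (hD0 z)
          apply mul_le_one₀ _ (abs_nonneg _)
          · rcases bval_cases f z with h | h <;> rcases bval_cases g z with h' | h' <;>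
            rcases bval_cases f (σ z) with h3 | h3 <;> rcases bval_cases g (σ z) with h4 | h4 <;>
            simp [h, h', h3, h4]
          · have := hy0 z
            have := hφ0 z
            rw [abs_of_nonneg (by positivity)]
            exact mul_le_one₀ (mul_le_one₀ (by linarith) (hy0 z) (hy1 z)) (hφ0 z) (hφ1 z)
        refine e1.trans ?_
        have := hD0 z
        rcases hz with hz | hz
        · rw [if_pos hz]; split_ifs <;> linarith
        · rw [if_pos hz]; split_ifs <;> linarith
      · push Not at hz
        have e1 : bval f z = bval g z := by unfold bval; rw [h z hz.1]
        have e2 : bval f (σ z) = bval g (σ z) := by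
          unfold bval; rw [h (σ z) (fun h' => hz.2 (by rw [← h']; simp))]
        simp [e1, e2, hz.1, hz.2]
    refine (Finset.sum_le_sum h2).trans ?_
    rw [Finset.sum_add_distrib, Finset.sum_ite_eq' Finset.univ x, Finset.sum_ite_eq' Finset.univ]
    simp [hc]
  have ht : 0 ≤ ε * q / 4 := by positivity
  have mZ := mcdiarmid_abs h0 h1 (Zval D y p) c hBZ (4 * norm2sq D) (ε * q / 4) (by linarith) hcC ht
  have mN := mcdiarmid_abs h0 h1 N c hBN (4 * norm2sq D) (ε * q / 4) (by linarith) hcC ht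
  rw [hEZ] at mZ
  rw [hEN] at mN
  have hexp : -((ε * q / 4) ^ 2 / (2 * (4 * norm2sq D))) =
      -(1 / 128 * ε ^ 2 * p ^ 2 * (1 - p) ^ 2) / norm2sq D := by
    rw [hq]; field_simp; norm_num
  rw [hexp] at mZ mN
  have hep := exp_pos (-(1 / 128 * ε ^ 2 * p ^ 2 * (1 - p) ^ 2) / norm2sq D)
  set EE := exp (-(1 / 128 * ε ^ 2 * p ^ 2 * (1 - p) ^ 2) / norm2sq D) with hEE
  have main : bEx X p (fun f => (1 : ℝ) - (if |Zval D y p f - q| > ε * q / 4 then 1 else 0)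
      - (if |N f - q * μ| > ε * q / 4 then 1 else 0)) ≤
      bprob X p (fun f => 0 < Zval D y p f ∧
          |(∑ x, filtered D y p f x * φ x * bval f x * bval f (σ x)) - μ| ≤ ε) := by
    refine bEx_mono h0 h1 ?_
    intro f
    by_cases hZ : |Zval D y p f - q| > ε * q / 4
    · rw [if_pos hZ]
      split_ifs <;> norm_num
    by_cases hNf : |N f - q * μ| > ε * q / 4
    · rw [if_pos hNf, if_neg hZ]
      split_ifs <;> norm_num
    have hZ' := abs_le.1 (not_lt.1 hZ)
    have hN' := abs_le.1 (not_lt.1 hNf)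
    have heq : ε * q ≤ q := by nlinarith
    have hZp : 3 / 4 * q ≤ Zval D y p f := by linarith [hZ'.1]
    have hZpos : 0 < Zval D y p f := by linarith
    have hnum : (∑ x, filtered D y p f x * φ x * bval f x * bval f (σ x)) =
        N f / Zval D y p f := by
      simp only [hN]
      rw [Finset.sum_div]
      apply Finset.sum_congr rfl
      intro x _
      unfold filtered
      rcases bval_cases f x with h | h <;> rw [h] <;> ring
    have good : 0 < Zval D y p f ∧
        |(∑ x, filtered D y p f x * φ x * bval f x * bval f (σ x)) - μ| ≤ ε := by
      refine ⟨hZpos, ?_⟩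
      rw [hnum]
      have e : N f / Zval D y p f - μ = (N f - μ * Zval D y p f) / Zval D y p f := by
        field_simp
      rw [e, abs_div, abs_of_pos hZpos, div_le_iff₀ hZpos]
      have e2 : |μ * (Zval D y p f - q)| ≤ ε * q / 4 := by
        rw [abs_mul, abs_of_nonneg hμ0]
        exact (mul_le_of_le_one_left (abs_nonneg _) hμ1).trans (not_lt.1 hZ)
      have e3 := abs_le.1 e2
      have e4 := mul_le_mul_of_nonneg_left hZp he0.le
      have e5 : 0 < ε * q := by positivity
      rw [abs_le]
      constructor <;> nlinarith [e3.1, e3.2, hN'.1, hN'.2]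
    rw [if_neg hZ, if_neg hNf, if_pos good]
    norm_num
  rw [bEx_sub, bEx_sub, bEx_const] at main
  linarith

end
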